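/- Fix an integer n with n ∉ {0, −1}. Let (A, B, X, Y) and (A′, B′, X′, Y′) be two irreducible quadruples of matrices in SL(2,ℂ), each satisfying the relations A² = B^{2n+1}, X⁻¹YX = Y⁻¹, B⁻ⁿA = Y⁻¹, A² = Y⁻¹X² (respectively with primes). If tr Y = tr Y′, then the two quadruples are simultaneously conjugate: there exists C ∈ SL(2,ℂ) with A′ = CAC⁻¹, B′ = CBC⁻¹, X′ = CXC⁻¹, and Y′ = CYC⁻¹. -/

import Mathlib

open Matrix Complex

abbrev SL2 := Matrix.SpecialLinearGroup (Fin 2) ℂ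

/-- A quadruple of `SL(2,ℂ)` matrices is irreducible if no one-dimensional subspace
of `ℂ²` is invariant under all four matrices, i.e. there is no common eigenvector. -/
def IrredQuad (A B X Y : SL2) : Prop :=
  ¬ ∃ v : Fin 2 → ℂ, v ≠ 0 ∧
    (∃ a : ℂ, (A : Matrix (Fin 2) (Fin 2) ℂ) *ᵥ v = a • v) ∧
    (∃ b : ℂ, (B : Matrix (Fin 2) (Fin 2) ℂ) *ᵥ v = b • v) ∧
    (∃ c : ℂ, (X : Matrix (Fin 2) (Fin 2) ℂ) *ᵥ v = c • v) ∧
    (∃ d : ℂ, (Y : Matrix (Fin 2) (Fin 2) ℂ) *ᵥ v = d • v)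

/-- In a group, if `b` commutes with `y`, the relations `a² = b^(2n+1)` and `b⁻ⁿa = y⁻¹`
express `a` and `b` as powers of `y`. -/
theorem eq_zpow_of_commute {G : Type*} [Group G] {n : ℤ} {a b y : G}
    (h1 : a ^ 2 = b ^ (2 * n + 1)) (h3 : b ^ (-n) * a = y⁻¹) (hc : Commute b y) :
    b = y ^ (-2 : ℤ) ∧ a = y ^ (-2 * n - 1) := by
  have ha : a = b ^ n * y⁻¹ := by
    rw [← h3, _root_.zpow_neg, mul_inv_cancel_left]
  have hcn : Commute (b ^ n) y⁻¹ := (hc.zpow_left n).inv_right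
  have hb : b = y ^ (-2 : ℤ) := by
    rw [ha, hcn.mul_pow, _root_.zpow_add, zpow_one, mul_comm 2 n, _root_.zpow_mul, zpow_ofNat] at h1
    rw [← mul_left_cancel h1, _root_.zpow_neg, inv_pow, zpow_ofNat]
  refine ⟨hb, ?_⟩
  rw [ha, hb, ← _root_.zpow_mul, ← _root_.zpow_neg_one, ← _root_.zpow_add, sub_eq_add_neg]

/-- The elements of `SL(2,ℂ)` having `v` as an eigenvector. -/
def lineStabilizer (v : Fin 2 → ℂ) : Subgroup SL2 where
  carrier := {g | ∃ a : ℂ, (g : Matrix (Fin 2) (Fin 2) ℂ) *ᵥ v = a • v}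
  one_mem' := ⟨1, by simp⟩
  mul_mem' := by
    rintro g k ⟨a, ha⟩ ⟨b, hb⟩
    refine ⟨b * a, ?_⟩
    rw [Matrix.SpecialLinearGroup.coe_mul, ← mulVec_mulVec, hb, mulVec_smul, ha, smul_smul]
  inv_mem' := by
    rintro g ⟨a, ha⟩
    refine ⟨(g : Matrix (Fin 2) (Fin 2) ℂ).trace - a, ?_⟩
    have hg : ((g⁻¹ : SL2) : Matrix (Fin 2) (Fin 2) ℂ)
        = (g : Matrix (Fin 2) (Fin 2) ℂ).trace • 1 - (g : Matrix (Fin 2) (Fin 2) ℂ) := by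
      rw [Matrix.SpecialLinearGroup.coe_inv, adjugate_fin_two]
      ext i j
      fin_cases i <;> fin_cases j <;> simp [trace_fin_two]
    rw [hg, sub_mulVec, smul_mulVec, one_mulVec, ha, sub_smul]

/-- A root of the characteristic polynomial of an element of `SL(2,ℂ)` has an eigenvector. -/
theorem exists_eigenvector (Y : SL2) {m : ℂ}
    (hm : m ^ 2 - (Y : Matrix (Fin 2) (Fin 2) ℂ).trace * m + 1 = 0) :
    ∃ v : Fin 2 → ℂ, v ≠ 0 ∧ (Y : Matrix (Fin 2) (Fin 2) ℂ) *ᵥ v = m • v := by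
  have hdet : ((Y : Matrix (Fin 2) (Fin 2) ℂ) - m • 1).det = 0 := by
    have hY := Y.det_coe
    rw [det_fin_two] at hY ⊢
    rw [trace_fin_two] at hm
    simp
    linear_combination hm + hY
  obtain ⟨v, hv, h⟩ := exists_mulVec_eq_zero_iff.mpr hdet
  refine ⟨v, hv, ?_⟩
  rwa [sub_mulVec, smul_mulVec, one_mulVec, sub_eq_zero] at h

theorem exists_charpoly_root (t : ℂ) : ∃ m : ℂ, m ^ 2 - t * m + 1 = 0 := by
  obtain ⟨s, hs⟩ := IsAlgClosed.exists_pow_nat_eq (t ^ 2 - 4) (n := 2) (by norm_num)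
  exact ⟨(t + s) / 2, by linear_combination hs / 4⟩

/-- If `X` conjugates `Y` to its inverse then `X` has trace zero or `Y` is scalar. -/
theorem trace_eq_zero_or_scalar {X Y : SL2} (h : X⁻¹ * Y * X = Y⁻¹) :
    (X : Matrix (Fin 2) (Fin 2) ℂ).trace = 0 ∨
      (Y : Matrix (Fin 2) (Fin 2) ℂ) = Y 0 0 • 1 := by
  have h' : Y * X = X * Y⁻¹ := by rw [← h]; group
  have hM := congrArg (fun g : SL2 => (g : Matrix (Fin 2) (Fin 2) ℂ)) h'
  simp only [Matrix.SpecialLinearGroup.coe_mul, Matrix.SpecialLinearGroup.coe_inv,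
    adjugate_fin_two] at hM
  have e00 := congrFun (congrFun hM 0) 0
  have e01 := congrFun (congrFun hM 0) 1
  have e10 := congrFun (congrFun hM 1) 0
  have e11 := congrFun (congrFun hM 1) 1
  simp [mul_apply, Fin.sum_univ_two] at e00 e01 e10 e11
  rw [or_iff_not_imp_left, trace_fin_two]
  intro hs
  have q : Y 0 1 = 0 := mul_left_cancel₀ hs (by linear_combination e01)
  have r : Y 1 0 = 0 := mul_left_cancel₀ hs (by linear_combination e10)
  have d : Y 1 1 = Y 0 0 := mul_left_cancel₀ hs (by linear_combination e11 - e00)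
  ext i j
  fin_cases i <;> fin_cases j <;> simp [q, r, d]

theorem sq_eq_neg_one_of_trace_eq_zero {X : SL2}
    (h : (X : Matrix (Fin 2) (Fin 2) ℂ).trace = 0) :
    (X : Matrix (Fin 2) (Fin 2) ℂ) * X.1 = -1 := by
  have hX := X.det_coe
  rw [det_fin_two] at hX
  rw [trace_fin_two] at h
  ext i j
  fin_cases i <;> fin_cases j <;> simp [mul_apply, Fin.sum_univ_two]
  · linear_combination X 0 0 * h - hX
  · linear_combination X 0 1 * h
  · linear_combination X 1 0 * h
  · linear_combination X 1 1 * h - hX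

/-- The relations force `B` to commute with `Y`. -/
theorem commute_of_relations {n : ℤ} {A B X Y : SL2} (h1 : A ^ 2 = B ^ (2 * n + 1))
    (h2 : X⁻¹ * Y * X = Y⁻¹) (h4 : A ^ 2 = Y⁻¹ * X ^ 2) : Commute B Y := by
  rcases trace_eq_zero_or_scalar h2 with h | h
  · have hz : Commute B (X ^ 2) := by
      apply Subtype.ext
      simp [pow_two, sq_eq_neg_one_of_trace_eq_zero h]
    have hh : Commute B (Y⁻¹ * X ^ 2) := by
      rw [← h4, h1]
      exact (Commute.refl B).zpow_right _
    have hY : Commute B (Y⁻¹ * X ^ 2 * (X ^ 2)⁻¹) := hh.mul_right hz.inv_right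
    rwa [mul_inv_cancel_right, Commute.inv_right_iff] at hY
  · apply Subtype.ext
    rw [Matrix.SpecialLinearGroup.coe_mul, Matrix.SpecialLinearGroup.coe_mul, h]
    simp

/-- A pair `X, Y` without common eigenvector such that `X` conjugates `Y` to `Y⁻¹` has a normal
form depending only on an eigenvalue `m` of `Y`. -/
theorem exists_normal_form {X Y : SL2} (h2 : X⁻¹ * Y * X = Y⁻¹)
    (hirr : ∀ v ≠ 0, X ∈ lineStabilizer v → Y ∉ lineStabilizer v) {m : ℂ}
    (hm : m ^ 2 - (Y : Matrix (Fin 2) (Fin 2) ℂ).trace * m + 1 = 0) :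
    ∃ P : SL2, (Y : Matrix (Fin 2) (Fin 2) ℂ) * P.1 = P.1 * !![m, 0; 0, m⁻¹] ∧
      (X : Matrix (Fin 2) (Fin 2) ℂ) * P.1 = P.1 * !![0, -1; 1, 0] := by
  have hX : (X : Matrix (Fin 2) (Fin 2) ℂ).trace = 0 := by
    refine (trace_eq_zero_or_scalar h2).resolve_right fun hY => ?_
    obtain ⟨k, hk⟩ := exists_charpoly_root (X : Matrix (Fin 2) (Fin 2) ℂ).trace
    obtain ⟨v, hv, hXv⟩ := exists_eigenvector X hk
    exact hirr v hv ⟨k, hXv⟩ ⟨Y 0 0, by rw [hY, smul_mulVec, one_mulVec]; simp⟩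
  have hXX := sq_eq_neg_one_of_trace_eq_zero hX
  have hm0 : m ≠ 0 := by
    rintro rfl
    simp at hm
  obtain ⟨v, hv, hYv⟩ := exists_eigenvector Y hm
  obtain ⟨w, hw⟩ : ∃ w, w = (X : Matrix (Fin 2) (Fin 2) ℂ) *ᵥ v := ⟨_, rfl⟩
  have hXw : (X : Matrix (Fin 2) (Fin 2) ℂ) *ᵥ w = -v := by
    rw [hw, mulVec_mulVec, hXX, neg_mulVec, one_mulVec]
  have hYw : (Y : Matrix (Fin 2) (Fin 2) ℂ) *ᵥ w = m⁻¹ • w := by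
    have h' : Y * X * Y = X := by
      have : Y * X = X * Y⁻¹ := by rw [← h2]; group
      rw [this, inv_mul_cancel_right]
    have hw' : (Y : Matrix (Fin 2) (Fin 2) ℂ) *ᵥ (m • w) = w := by
      rw [hw, ← mulVec_smul, ← hYv, mulVec_mulVec, mulVec_mulVec,
        ← Matrix.SpecialLinearGroup.coe_mul,
        ← Matrix.SpecialLinearGroup.coe_mul, h']
    rw [mulVec_smul] at hw'
    rw [← hw', smul_smul, inv_mul_cancel₀ hm0, one_smul, hw']
  have hδ : v 0 * w 1 - w 0 * v 1 ≠ 0 := by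
    intro h0
    refine hirr v hv ?_ ⟨m, hYv⟩
    change ∃ a : ℂ, _
    rw [← hw]
    by_cases hv0 : v 0 = 0
    · have hv1 : v 1 ≠ 0 := by
        intro hv1
        exact hv (by ext i; fin_cases i <;> simp [hv0, hv1])
      refine ⟨w 1 / v 1, ?_⟩
      ext i
      fin_cases i <;> simp <;> field_simp
      linear_combination -h0
    · refine ⟨w 0 / v 0, ?_⟩
      ext i
      fin_cases i <;> simp <;> field_simp
      linear_combination h0
  obtain ⟨c, hc⟩ := IsAlgClosed.exists_pow_nat_eq (v 0 * w 1 - w 0 * v 1)⁻¹ (n := 2) (by norm_num)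
  refine ⟨⟨!![c * v 0, c * w 0; c * v 1, c * w 1], ?_⟩, ?_, ?_⟩
  · rw [det_fin_two_of]
    linear_combination (v 0 * w 1 - w 0 * v 1) * hc + mul_inv_cancel₀ hδ
  · have a0 := congrFun hYv 0
    have a1 := congrFun hYv 1
    have b0 := congrFun hYw 0
    have b1 := congrFun hYw 1
    simp [mulVec, dotProduct, Fin.sum_univ_two] at a0 a1 b0 b1
    ext i j
    fin_cases i <;> fin_cases j <;> simp [mul_apply, Fin.sum_univ_two]
    · linear_combination c * a0
    · linear_combination c * b0
    · linear_combination c * a1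
    · linear_combination c * b1
  · have a0 := congrFun hw 0
    have a1 := congrFun hw 1
    have b0 := congrFun hXw 0
    have b1 := congrFun hXw 1
    simp [mulVec, dotProduct, Fin.sum_univ_two] at a0 a1 b0 b1
    ext i j
    fin_cases i <;> fin_cases j <;> simp [mul_apply, Fin.sum_univ_two]
    · linear_combination -c * a0
    · linear_combination c * b0
    · linear_combination -c * a1
    · linear_combination c * b1

/-- Two elements of `SL(2,ℂ)` with a common normal form are conjugate, by the quotient of the
base changes. -/
theorem eq_conj_of_mul_eq {g g' P Q : SL2} {D : Matrix (Fin 2) (Fin 2) ℂ}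
    (h : (g : Matrix (Fin 2) (Fin 2) ℂ) * P.1 = P.1 * D)
    (h' : (g' : Matrix (Fin 2) (Fin 2) ℂ) * Q = Q * D) :
    g' = (Q * P⁻¹) * g * (Q * P⁻¹)⁻¹ := by
  have cancel (R : SL2) : ((R⁻¹ : SL2) : Matrix (Fin 2) (Fin 2) ℂ) * R = 1 := by
    rw [← Matrix.SpecialLinearGroup.coe_mul, inv_mul_cancel, Matrix.SpecialLinearGroup.coe_one]
  have key : P⁻¹ * g * P = Q⁻¹ * g' * Q := by
    apply Subtype.ext
    simp only [Matrix.SpecialLinearGroup.coe_mul, mul_assoc, h, h']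
    rw [← mul_assoc, ← mul_assoc, cancel, cancel]
  calc g' = Q * (Q⁻¹ * g' * Q) * Q⁻¹ := by group
    _ = _ := by rw [← key]; group

theorem irrep_determined_by_trace (n : ℤ) (hn0 : n ≠ 0) (hn1 : n ≠ -1)
    (A B X Y A' B' X' Y' : SL2)
    (h1 : A ^ 2 = B ^ (2 * n + 1))
    (h2 : X⁻¹ * Y * X = Y⁻¹)
    (h3 : B ^ (-n) * A = Y⁻¹)
    (h4 : A ^ 2 = Y⁻¹ * X ^ 2)
    (hirr : IrredQuad A B X Y)
    (h1' : A' ^ 2 = B' ^ (2 * n + 1))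
    (h2' : X'⁻¹ * Y' * X' = Y'⁻¹)
    (h3' : B' ^ (-n) * A' = Y'⁻¹)
    (h4' : A' ^ 2 = Y'⁻¹ * X' ^ 2)
    (hirr' : IrredQuad A' B' X' Y')
    (htr : Matrix.trace (Y : Matrix (Fin 2) (Fin 2) ℂ) =
           Matrix.trace (Y' : Matrix (Fin 2) (Fin 2) ℂ)) :
    ∃ C : SL2, A' = C * A * C⁻¹ ∧ B' = C * B * C⁻¹ ∧
      X' = C * X * C⁻¹ ∧ Y' = C * Y * C⁻¹ := by
  obtain ⟨hB, hA⟩ := eq_zpow_of_commute h1 h3 (commute_of_relations h1 h2 h4)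
  obtain ⟨hB', hA'⟩ := eq_zpow_of_commute h1' h3' (commute_of_relations h1' h2' h4')
  obtain ⟨m, hm⟩ := exists_charpoly_root (Y : Matrix (Fin 2) (Fin 2) ℂ).trace
  obtain ⟨P, hYP, hXP⟩ := exists_normal_form h2 (fun v hv hX hY => hirr
    ⟨v, hv, hA ▸ (lineStabilizer v).zpow_mem hY _, hB ▸ (lineStabilizer v).zpow_mem hY _,
      hX, hY⟩) hm
  obtain ⟨Q, hYQ, hXQ⟩ := exists_normal_form h2' (fun v hv hX hY => hirr'
    ⟨v, hv, hA' ▸ (lineStabilizer v).zpow_mem hY _, hB' ▸ (lineStabilizer v).zpow_mem hY _,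
      hX, hY⟩) (htr ▸ hm)
  have hY := eq_conj_of_mul_eq hYP hYQ
  refine ⟨Q * P⁻¹, ?_, ?_, eq_conj_of_mul_eq hXP hXQ, hY⟩
  · rw [hA, hA', ← conj_zpow, ← hY]
  · rw [hB, hB', ← conj_zpow, ← hY]
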